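/- arXiv:2202.10602 — 5 statements merged into one kernel-verified Lean document; each statement's English description precedes it below -/
import Mathlib

section
/- (Theorem 1: robust counterpart under center-connected ellipsoidal uncertainty.) In the connected ellipsoidal setting, for any B ∈ ℝ, the robust constraint 'Σ_{t=1}^T d_tᵀ x_t ≤ B for every admissible sequence (d_1,…,d_T)' holds if and only if μ₁ᵀ y₁ + C₁ + R₁ ≤ B. -/
open Matrix Finset

/-- The Euclidean norm of a vector in `ℝⁿ`. -/
noncomputable def euclNorm {n : ℕ} (v : Fin n → ℝ) : ℝ := Real.sqrt (∑ i, v i ^ 2)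

/-- Admissibility of a realization sequence `d` (0-indexed: periods `0,…,T-1`
correspond to `1,…,T`) in the connected ellipsoidal setting: the centers `μ` are
generated from `μ₁` by the recursion `μ_{t+1} = A_t μ_t + F_t d_t + c_t`, and each
`d_t` lies in the ellipsoid with center `μ_t`, shape matrix `L_t` and radius `r_t`. -/
def EllipsoidAdmissible {n : ℕ} (T : ℕ) (μ₁ : Fin n → ℝ)
    (A F : ℕ → Matrix (Fin n) (Fin n) ℝ) (c : ℕ → Fin n → ℝ)
    (L : ℕ → Matrix (Fin n) (Fin n) ℝ) (r : ℕ → ℝ)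
    (d : ℕ → Fin n → ℝ) : Prop :=
  ∃ μ : ℕ → Fin n → ℝ, μ 0 = μ₁ ∧
    (∀ t, μ (t + 1) = A t *ᵥ μ t + F t *ᵥ d t + c t) ∧
    (∀ t < T, ∃ u : Fin n → ℝ, euclNorm u ≤ r t ∧ d t = μ t + L t *ᵥ u)

/-- Cauchy–Schwarz for the Euclidean norm. -/
lemma dotProduct_le_euclNorm_mul {n : ℕ} (u v : Fin n → ℝ) :
    u ⬝ᵥ v ≤ euclNorm u * euclNorm v :=
  Real.sum_mul_le_sqrt_mul_sqrt Finset.univ u v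

lemma euclNorm_nonneg {n : ℕ} (v : Fin n → ℝ) : 0 ≤ euclNorm v :=
  Real.sqrt_nonneg _

lemma dotProduct_self_eq_euclNorm_sq {n : ℕ} (v : Fin n → ℝ) :
    v ⬝ᵥ v = euclNorm v ^ 2 := by
  rw [euclNorm, Real.sq_sqrt (Finset.sum_nonneg fun i _ => sq_nonneg (v i))]
  exact Finset.sum_congr rfl fun i _ => (sq (v i)).symm

lemma euclNorm_smul {n : ℕ} {a : ℝ} (ha : 0 ≤ a) (v : Fin n → ℝ) :
    euclNorm (a • v) = a * euclNorm v := by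
  simp only [euclNorm, Pi.smul_apply, smul_eq_mul, mul_pow, ← Finset.mul_sum]
  rw [Real.sqrt_mul (sq_nonneg a), Real.sqrt_sq ha]

/-- The support function of a Euclidean ball is attained. -/
lemma exists_euclNorm_le_dotProduct_eq {n : ℕ} {r : ℝ} (hr : 0 ≤ r) (q : Fin n → ℝ) :
    ∃ u : Fin n → ℝ, euclNorm u ≤ r ∧ u ⬝ᵥ q = r * euclNorm q := by
  rcases (euclNorm_nonneg q).eq_or_lt with h | h
  · refine ⟨0, by simpa [euclNorm] using hr, ?_⟩
    simp [← h]
  · refine ⟨(r / euclNorm q) • q, ?_, ?_⟩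
    · rw [euclNorm_smul (by positivity), div_mul_cancel₀ _ h.ne']
    · rw [smul_dotProduct, dotProduct_self_eq_euclNorm_sq, smul_eq_mul]
      field_simp

/-- One step of the dual recursion for the cost of a realization. -/
lemma dotProduct_add_center_step {n : ℕ} (x y' c μ u : Fin n → ℝ)
    (A F L : Matrix (Fin n) (Fin n) ℝ) :
    (μ + L *ᵥ u) ⬝ᵥ x + (A *ᵥ μ + F *ᵥ (μ + L *ᵥ u) + c) ⬝ᵥ y' =
      μ ⬝ᵥ (x + (F + A)ᵀ *ᵥ y') + c ⬝ᵥ y' + u ⬝ᵥ (Lᵀ *ᵥ (x + Fᵀ *ᵥ y')) := by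
  have adj (M : Matrix (Fin n) (Fin n) ℝ) (v w : Fin n → ℝ) :
      v ⬝ᵥ (Mᵀ *ᵥ w) = (M *ᵥ v) ⬝ᵥ w := by
    rw [dotProduct_mulVec, vecMul_transpose]
  simp only [adj, dotProduct_add, add_dotProduct, mulVec_add, add_mulVec]
  ring

/-- The total cost of a realization in terms of the deviations `u`. -/
lemma sum_dotProduct_eq_of_recursion {n T : ℕ} {x c y μ d u : ℕ → Fin n → ℝ}
    {L A F : ℕ → Matrix (Fin n) (Fin n) ℝ} {C : ℕ → ℝ}
    (hyT : y T = 0) (hy : ∀ k < T, y k = x k + (F k + A k)ᵀ *ᵥ y (k + 1))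
    (hCT : C T = 0) (hC : ∀ k < T, C k = c k ⬝ᵥ y (k + 1) + C (k + 1))
    (hμ : ∀ t, μ (t + 1) = A t *ᵥ μ t + F t *ᵥ d t + c t)
    (hd : ∀ t < T, d t = μ t + L t *ᵥ u t) :
    ∑ t ∈ Finset.range T, d t ⬝ᵥ x t =
      μ 0 ⬝ᵥ y 0 + C 0 +
        ∑ t ∈ Finset.range T, u t ⬝ᵥ ((L t)ᵀ *ᵥ (x t + (F t)ᵀ *ᵥ y (t + 1))) := by
  have key : ∀ m ≤ T, ∑ t ∈ Finset.range m, d t ⬝ᵥ x t + μ m ⬝ᵥ y m + C m =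
      μ 0 ⬝ᵥ y 0 + C 0 +
        ∑ t ∈ Finset.range m, u t ⬝ᵥ ((L t)ᵀ *ᵥ (x t + (F t)ᵀ *ᵥ y (t + 1))) := by
    intro m
    induction m with
    | zero => simp
    | succ m ih =>
      intro hm
      have ih := ih (by omega)
      have step := dotProduct_add_center_step (x m) (y (m + 1)) (c m) (μ m) (u m)
        (A m) (F m) (L m)
      rw [← hd m hm, ← hμ m, ← hy m hm] at step
      rw [Finset.sum_range_succ, Finset.sum_range_succ]
      linarith [hC m hm]
  simpa [hyT, hCT] using key T le_rfl

/-- The robust counterpart when the backward recursions start from zero at time `T`. -/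
lemma robust_counterpart_of_zero_terminal {n T : ℕ} {x c y : ℕ → Fin n → ℝ}
    {L A F : ℕ → Matrix (Fin n) (Fin n) ℝ} {r C R : ℕ → ℝ} (hr : ∀ t, 0 ≤ r t)
    (μ₁ : Fin n → ℝ)
    (hyT : y T = 0) (hy : ∀ k < T, y k = x k + (F k + A k)ᵀ *ᵥ y (k + 1))
    (hCT : C T = 0) (hC : ∀ k < T, C k = c k ⬝ᵥ y (k + 1) + C (k + 1))
    (hRT : R T = 0)
    (hR : ∀ k < T,
      R k = r k * euclNorm ((L k)ᵀ *ᵥ (x k + (F k)ᵀ *ᵥ y (k + 1))) + R (k + 1))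
    (B : ℝ) :
    (∀ d : ℕ → Fin n → ℝ, EllipsoidAdmissible T μ₁ A F c L r d →
        ∑ t ∈ Finset.range T, d t ⬝ᵥ x t ≤ B) ↔
      μ₁ ⬝ᵥ y 0 + C 0 + R 0 ≤ B := by
  have hR0 : R 0 = ∑ t ∈ Finset.range T,
      r t * euclNorm ((L t)ᵀ *ᵥ (x t + (F t)ᵀ *ᵥ y (t + 1))) := by
    rw [← sub_zero (R 0), ← hRT, ← Finset.sum_range_sub']
    refine Finset.sum_congr rfl fun t ht => ?_
    rw [hR t (Finset.mem_range.mp ht), add_sub_cancel_right]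
  constructor
  · intro h
    choose u hu hq using fun t =>
      exists_euclNorm_le_dotProduct_eq (hr t) ((L t)ᵀ *ᵥ (x t + (F t)ᵀ *ᵥ y (t + 1)))
    let μ : ℕ → Fin n → ℝ := Nat.rec μ₁ fun t m =>
      A t *ᵥ m + F t *ᵥ (m + L t *ᵥ u t) + c t
    have hB := h (fun t => μ t + L t *ᵥ u t)
      ⟨μ, rfl, fun _ => rfl, fun t _ => ⟨u t, hu t, rfl⟩⟩
    rw [sum_dotProduct_eq_of_recursion hyT hy hCT hC (μ := μ) (fun _ => rfl)
      (fun _ _ => rfl), Finset.sum_congr rfl fun t _ => hq t, ← hR0] at hB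
    exact hB
  · rintro h d ⟨μ, rfl, hμ, hd⟩
    choose! u hu hd using hd
    rw [sum_dotProduct_eq_of_recursion hyT hy hCT hC hμ hd]
    refine le_trans (add_le_add_right ?_ _) h
    rw [hR0]
    refine Finset.sum_le_sum fun t ht => (dotProduct_le_euclNorm_mul _ _).trans ?_
    exact mul_le_mul_of_nonneg_right (hu t (Finset.mem_range.mp ht)) (euclNorm_nonneg _)

/-- Theorem 1: robust counterpart under center-connected ellipsoidal uncertainty.
With `y`, `C`, `R` defined by the backward recursions
`y_T = x_T`, `y_k = x_k + (F_k + A_k)ᵀ y_{k+1}`;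
`C_T = 0`, `C_k = c_kᵀ y_{k+1} + C_{k+1}`;
`R_T = r_T ‖L_Tᵀ x_T‖₂`, `R_k = r_k ‖L_kᵀ (x_k + F_kᵀ y_{k+1})‖₂ + R_{k+1}`,
the robust constraint `Σ_t d_tᵀ x_t ≤ B` over all admissible sequences holds iff
`μ₁ᵀ y₁ + C₁ + R₁ ≤ B`. -/
theorem connected_ellipsoid_robust_counterpart
    (n T : ℕ) (hn : 1 ≤ n) (hT : 1 ≤ T)
    (x : ℕ → Fin n → ℝ) (L A F : ℕ → Matrix (Fin n) (Fin n) ℝ)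
    (r : ℕ → ℝ) (hr : ∀ t, 0 ≤ r t) (c : ℕ → Fin n → ℝ) (μ₁ : Fin n → ℝ)
    (y : ℕ → Fin n → ℝ) (C R : ℕ → ℝ)
    (hyT : y (T - 1) = x (T - 1))
    (hy : ∀ k, k + 1 < T → y k = x k + (F k + A k)ᵀ *ᵥ y (k + 1))
    (hCT : C (T - 1) = 0)
    (hC : ∀ k, k + 1 < T → C k = c k ⬝ᵥ y (k + 1) + C (k + 1))
    (hRT : R (T - 1) = r (T - 1) * euclNorm ((L (T - 1))ᵀ *ᵥ x (T - 1)))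
    (hR : ∀ k, k + 1 < T →
      R k = r k * euclNorm ((L k)ᵀ *ᵥ (x k + (F k)ᵀ *ᵥ y (k + 1))) + R (k + 1))
    (B : ℝ) :
    (∀ d : ℕ → Fin n → ℝ, EllipsoidAdmissible T μ₁ A F c L r d →
        ∑ t ∈ Finset.range T, d t ⬝ᵥ x t ≤ B) ↔
      μ₁ ⬝ᵥ y 0 + C 0 + R 0 ≤ B := by
  have h0 : 0 < T := hT
  have hlast {k : ℕ} (hk : k < T) (hk' : ¬ k + 1 < T) : k = T - 1 := by omega
  have := robust_counterpart_of_zero_terminal (n := n) (T := T) (x := x) (c := c)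
    (L := L) (A := A) (F := F) (r := r)
    (y := fun k => if k < T then y k else 0) (C := fun k => if k < T then C k else 0)
    (R := fun k => if k < T then R k else 0) hr μ₁ (by simp) ?_ (by simp) ?_ (by simp) ?_ B
  · simpa only [h0, if_true] using this
  all_goals
    intro k hk
    by_cases hk' : k + 1 < T
    · simp only [hk, hk', if_true]
      first | exact hy k hk' | exact hC k hk' | exact hR k hk'
    · obtain rfl := hlast hk hk'
      simp only [hk, hk', if_true, if_false]
      simp [hyT, hCT, hRT]
end

section
/- (Theorem 3: robust counterpart under RHS-connected polyhedral uncertainty.) In the connected polyhedral setting, assume U₁ is nonempty and that for every t = 2,…,T and every admissible prefix (d_1,…,d_{t−1}) the set U_t(d_{t−1}) is nonempty. Then for any B ∈ ℝ, the robust constraint 'Σ_{t=1}^T d_tᵀ x_t ≤ B for every admissible sequence (d_1,…,d_T)' holds if and only if there exist vectors q_t ∈ ℝ^{m_t} for t = 1,…,T with q_t ≤ 0 componentwise, G_tᵀ q_t = x_t + Δ_{t+1}ᵀ q_{t+1} for t = 1,…,T (with the convention Δ_{T+1}ᵀ q_{T+1} = 0), and Σ_{t=1}^T g_tᵀ q_t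 ≤ B. -/
open Matrix Finset

/-- Admissibility of a realization sequence in the connected polyhedral setting
(0-indexed): `G_t d_t ≥ g_t + Δ_t d_{t−1}` componentwise for every period `t < T`
(with `Δ_0 = 0`, so the first period constraint reads `G_0 d_0 ≥ g_0`). -/
def PolyAdmissible {n : ℕ} (T : ℕ) (m : ℕ → ℕ)
    (G : (t : ℕ) → Matrix (Fin (m t)) (Fin n) ℝ)
    (g : (t : ℕ) → Fin (m t) → ℝ)
    (Δ : (t : ℕ) → Matrix (Fin (m t)) (Fin n) ℝ)
    (d : ℕ → Fin n → ℝ) : Prop :=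
  ∀ t < T, ∀ i, g t i + (Δ t *ᵥ d (t - 1)) i ≤ (G t *ᵥ d t) i

/-- **Farkas' lemma** for finitely many linear functionals on an arbitrary real vector space. -/
theorem exists_nonneg_eq_sum_smul_of_forall_nonpos {ι V : Type*} [AddCommGroup V] [Module ℝ V]
    (s : Finset ι) (a : ι → V →ₗ[ℝ] ℝ) (b : V →ₗ[ℝ] ℝ)
    (h : ∀ v, (∀ i ∈ s, a i v ≤ 0) → b v ≤ 0) :
    ∃ l : ι → ℝ, (∀ i ∈ s, 0 ≤ l i) ∧ b = ∑ i ∈ s, l i • a i := by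
  classical
  induction s using Finset.induction_on generalizing a b with
  | empty =>
    refine ⟨0, by simp, ?_⟩
    ext v
    have h1 := h v (by simp)
    have h2 := h (-v) (by simp)
    simp only [map_neg] at h2
    simp only [Finset.sum_empty, LinearMap.zero_apply]
    linarith
  | insert j s hj ih =>
    by_cases hs : ∀ v, (∀ i ∈ s, a i v ≤ 0) → b v ≤ 0
    · obtain ⟨l, hl, hb⟩ := ih a b hs
      refine ⟨Function.update l j 0, ?_, ?_⟩
      · intro i hi
        by_cases hij : i = j
        · simp [hij]
        · simpa [hij] using hl i ((Finset.mem_insert.1 hi).resolve_left hij)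
      · rw [Finset.sum_insert hj, hb, Function.update_self, zero_smul, zero_add]
        refine Finset.sum_congr rfl fun i hi => ?_
        rw [Function.update_of_ne (ne_of_mem_of_not_mem hi hj)]
    · push Not at hs
      obtain ⟨w, hw, hbw⟩ := hs
      have hjw : 0 < a j w := by
        by_contra! hc
        exact absurd (h w (by simpa [hc] using hw)) (not_le.2 hbw)
      obtain ⟨l, hl, hb⟩ := ih (fun i => a i - (a i w / a j w) • a j)
        (b - (b w / a j w) • a j) (by
          intro v hv
          have := h (v - (a j v / a j w) • w) (by
            intro i hi
            rcases Finset.mem_insert.1 hi with rfl | hi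
            · simp [hjw.ne']
            · have := hv i hi
              simp only [LinearMap.sub_apply, LinearMap.smul_apply, smul_eq_mul, map_sub,
                map_smul] at this ⊢
              convert this using 2
              ring)
          simp only [LinearMap.sub_apply, LinearMap.smul_apply, smul_eq_mul, map_sub,
            map_smul] at this ⊢
          convert this using 2
          ring)
      refine ⟨Function.update l j ((b w - ∑ i ∈ s, l i * a i w) / a j w), ?_, ?_⟩
      · intro i hi
        by_cases hij : i = j
        · subst hij
          have : ∑ k ∈ s, l k * a k w ≤ 0 :=
            Finset.sum_nonpos fun k hk => mul_nonpos_of_nonneg_of_nonpos (hl k hk) (hw k hk)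
          rw [Function.update_self]
          exact div_nonneg (by linarith) hjw.le
        · simpa [hij] using hl i ((Finset.mem_insert.1 hi).resolve_left hij)
      · rw [Finset.sum_insert hj, Function.update_self]
        have hsum : ∑ i ∈ s, Function.update l j ((b w - ∑ i ∈ s, l i * a i w) / a j w) i • a i =
            ∑ i ∈ s, l i • a i := Finset.sum_congr rfl fun i hi => by
          rw [Function.update_of_ne (ne_of_mem_of_not_mem hi hj)]
        rw [hsum]
        ext v
        have hv := congrArg (fun f => f v) hb
        simp only [LinearMap.sub_apply, LinearMap.add_apply, LinearMap.smul_apply, smul_eq_mul,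
          LinearMap.sum_apply, mul_sub, Finset.sum_sub_distrib] at hv ⊢
        have hfac : ∑ i ∈ s, l i * (a i w / a j w * a j v) =
            (∑ i ∈ s, l i * a i w) / a j w * a j v := by
          rw [Finset.sum_div, Finset.sum_mul]
          exact Finset.sum_congr rfl fun i _ => by ring
        rw [hfac] at hv
        rw [sub_div, sub_mul]
        linarith

/-- Affine form of **Farkas' lemma**: an upper bound `c v ≤ β` valid on a nonempty polyhedron
`{v | ∀ i ∈ s, b i ≤ a i v}` is certified by nonpositive multipliers. -/
theorem exists_nonpos_certificate_of_forall_le {ι V : Type*} [AddCommGroup V] [Module ℝ V]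
    (s : Finset ι) (a : ι → V →ₗ[ℝ] ℝ) (b : ι → ℝ) (c : V →ₗ[ℝ] ℝ) (β : ℝ)
    (hne : ∃ v, ∀ i ∈ s, b i ≤ a i v)
    (h : ∀ v, (∀ i ∈ s, b i ≤ a i v) → c v ≤ β) :
    ∃ q : ι → ℝ, (∀ i ∈ s, q i ≤ 0) ∧ (∀ v, c v = ∑ i ∈ s, q i * a i v) ∧
      ∑ i ∈ s, b i * q i ≤ β := by
  classical
  obtain ⟨w, hw⟩ := hne
  obtain ⟨l, hl, hc⟩ := exists_nonneg_eq_sum_smul_of_forall_nonpos (V := V × ℝ)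
    (Finset.insertNone s)
    (fun o => o.elim (-LinearMap.snd ℝ V ℝ)
      fun i => b i • LinearMap.snd ℝ V ℝ - a i ∘ₗ LinearMap.fst ℝ V ℝ)
    (c ∘ₗ LinearMap.fst ℝ V ℝ - β • LinearMap.snd ℝ V ℝ) (by
      rintro ⟨v, r⟩ hv
      have hr : 0 ≤ r := by simpa using hv none (by simp)
      have hi : ∀ i ∈ s, b i * r ≤ a i v := fun i hi => by
        simpa using hv (some i) (by simpa using hi)
      suffices c v ≤ β * r by simpa using this
      rcases hr.eq_or_lt with rfl | hr
      · rw [mul_zero]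
        by_contra! hcv
        obtain ⟨k, hk⟩ := exists_nat_gt ((β - c w) / c v)
        rw [div_lt_iff₀ hcv] at hk
        have := h (w + (k : ℝ) • v) fun i his => by
          have h1 := hi i his
          rw [mul_zero] at h1
          have h2 := mul_nonneg k.cast_nonneg (α := ℝ) h1
          have h3 := hw i his
          simp only [map_add, map_smul, smul_eq_mul]
          linarith
        simp only [map_add, map_smul, smul_eq_mul] at this
        linarith
      · have := h (r⁻¹ • v) fun i his => by
          rw [map_smul, smul_eq_mul, inv_mul_eq_div, le_div_iff₀ hr]
          exact hi i his
        rwa [map_smul, smul_eq_mul, inv_mul_eq_div, div_le_iff₀ hr] at this)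
  refine ⟨fun i => -l (some i), fun i hi => ?_, fun v => ?_, ?_⟩
  · simpa using hl (some i) (by simpa using hi)
  · simpa [Finset.sum_insertNone] using congrArg (fun f => f (v, 0)) hc
  · have h0 : 0 ≤ l none := hl none (by simp)
    have h1 := congrArg (fun f => f ((0 : V), (1 : ℝ))) hc
    simp only [LinearMap.sub_apply, LinearMap.comp_apply, LinearMap.fst_apply, map_zero,
      LinearMap.smul_apply, LinearMap.snd_apply, smul_eq_mul, mul_one,
      LinearMap.sum_apply, LinearMap.add_apply,
      Finset.sum_insertNone, Option.elim_none, Option.elim_some, LinearMap.neg_apply,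
      sub_zero, zero_sub] at h1
    have h2 : ∑ i ∈ s, b i * -l (some i) = -∑ i ∈ s, l (some i) * b i := by
      rw [← Finset.sum_neg_distrib]
      exact Finset.sum_congr rfl fun i _ => by ring
    rw [h2]
    linarith

/-- The residual of the dual equation in period `t` of a horizon with last period `k`. -/
def dualResidual {n : ℕ} (k : ℕ) {m : ℕ → ℕ} (G Δ : (t : ℕ) → Matrix (Fin (m t)) (Fin n) ℝ)
    (q : (t : ℕ) → Fin (m t) → ℝ) (t : ℕ) : Fin n → ℝ :=
  (G t)ᵀ *ᵥ q t - if t < k then (Δ (t + 1))ᵀ *ᵥ q (t + 1) else 0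

/-- Summation by parts: pairing the constraints with multipliers, regrouped by period of `d`. -/
theorem sum_dotProduct_mulVec_sub {n : ℕ} (k : ℕ) {m : ℕ → ℕ}
    (G Δ : (t : ℕ) → Matrix (Fin (m t)) (Fin n) ℝ) (hΔ0 : Δ 0 = 0)
    (q : (t : ℕ) → Fin (m t) → ℝ) (d : ℕ → Fin n → ℝ) :
    ∑ t ∈ Finset.range (k + 1), q t ⬝ᵥ (G t *ᵥ d t - Δ t *ᵥ d (t - 1)) =
      ∑ t ∈ Finset.range (k + 1), d t ⬝ᵥ dualResidual k G Δ q t := by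
  have htr : ∀ {p : ℕ} (M : Matrix (Fin p) (Fin n) ℝ) (u : Fin p → ℝ) (v : Fin n → ℝ),
      v ⬝ᵥ (Mᵀ *ᵥ u) = u ⬝ᵥ (M *ᵥ v) := fun M u v => by
    rw [mulVec_transpose, dotProduct_comm, dotProduct_mulVec]
  simp only [dualResidual, dotProduct_sub, Finset.sum_sub_distrib, htr]
  congr 1
  rw [Finset.sum_range_succ', Finset.sum_range_succ]
  simp only [hΔ0, zero_mulVec, dotProduct_zero, lt_irrefl, if_false, add_tsub_cancel_right]
  congr 1
  refine Finset.sum_congr rfl fun t ht => ?_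
  rw [if_pos (Finset.mem_range.1 ht), htr]

/-- If every admissible prefix can be continued, then an admissible sequence exists. -/
theorem exists_polyAdmissible {n T : ℕ} {m : ℕ → ℕ}
    {G : (t : ℕ) → Matrix (Fin (m t)) (Fin n) ℝ} {g : (t : ℕ) → Fin (m t) → ℝ}
    {Δ : (t : ℕ) → Matrix (Fin (m t)) (Fin n) ℝ} (hΔ0 : Δ 0 = 0)
    (hne : ∀ t < T, ∀ d : ℕ → Fin n → ℝ, PolyAdmissible t m G g Δ d →
      ∃ e : Fin n → ℝ, ∀ i, g t i + (Δ t *ᵥ d (t - 1)) i ≤ (G t *ᵥ e) i) :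
    ∃ d, PolyAdmissible T m G g Δ d := by
  suffices ∀ t ≤ T, ∃ d, PolyAdmissible t m G g Δ d from this T le_rfl
  intro t
  induction t with
  | zero => exact fun _ => ⟨0, fun s hs => absurd hs s.not_lt_zero⟩
  | succ t ih =>
    intro ht
    obtain ⟨d, hd⟩ := ih (by omega)
    obtain ⟨e, he⟩ := hne t ht d hd
    refine ⟨Function.update d t e, fun s hs i => ?_⟩
    rcases Nat.lt_succ_iff_lt_or_eq.1 hs with hs | rfl
    · rw [Function.update_of_ne hs.ne, Function.update_of_ne (by omega : s - 1 ≠ t)]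
      exact hd s hs i
    · rw [Function.update_self]
      rcases s.eq_zero_or_pos with rfl | hpos
      · simpa [hΔ0] using he i
      · rw [Function.update_of_ne (by omega : s - 1 ≠ s)]
        exact he i

/-- Theorem 3: robust counterpart under RHS-connected polyhedral uncertainty.
Assuming all uncertainty sets along admissible prefixes are nonempty, the robust
constraint `Σ_t d_tᵀ x_t ≤ B` over all admissible sequences holds iff there exist
dual multipliers `q_t ≤ 0` with `G_tᵀ q_t = x_t + Δ_{t+1}ᵀ q_{t+1}` (and
`G_Tᵀ q_T = x_T` for the last period) such that `Σ_t g_tᵀ q_t ≤ B`. -/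
theorem connected_polyhedral_robust_counterpart
    (n T : ℕ) (hn : 1 ≤ n) (hT : 1 ≤ T) (m : ℕ → ℕ)
    (x : ℕ → Fin n → ℝ)
    (G : (t : ℕ) → Matrix (Fin (m t)) (Fin n) ℝ)
    (g : (t : ℕ) → Fin (m t) → ℝ)
    (Δ : (t : ℕ) → Matrix (Fin (m t)) (Fin n) ℝ)
    (hΔ0 : Δ 0 = 0)
    (hne : ∀ t < T, ∀ d : ℕ → Fin n → ℝ,
      (∀ s < t, ∀ i, g s i + (Δ s *ᵥ d (s - 1)) i ≤ (G s *ᵥ d s) i) →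
      ∃ e : Fin n → ℝ, ∀ i, g t i + (Δ t *ᵥ d (t - 1)) i ≤ (G t *ᵥ e) i)
    (B : ℝ) :
    (∀ d : ℕ → Fin n → ℝ, PolyAdmissible T m G g Δ d →
        ∑ t ∈ Finset.range T, d t ⬝ᵥ x t ≤ B) ↔
      ∃ q : (t : ℕ) → Fin (m t) → ℝ,
        (∀ t < T, ∀ i, q t i ≤ 0) ∧
        (∀ t, t + 1 < T → (G t)ᵀ *ᵥ q t = x t + (Δ (t + 1))ᵀ *ᵥ q (t + 1)) ∧
        (G (T - 1))ᵀ *ᵥ q (T - 1) = x (T - 1) ∧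
        ∑ t ∈ Finset.range T, g t ⬝ᵥ q t ≤ B := by
  obtain ⟨k, rfl⟩ : ∃ k, T = k + 1 := ⟨T - 1, by omega⟩
  have hres : ∀ q : (t : ℕ) → Fin (m t) → ℝ, (∀ t < k + 1, dualResidual k G Δ q t = x t) ↔
      (∀ t, t + 1 < k + 1 → (G t)ᵀ *ᵥ q t = x t + (Δ (t + 1))ᵀ *ᵥ q (t + 1)) ∧
        (G k)ᵀ *ᵥ q k = x k := by
    intro q
    refine ⟨fun h => ⟨fun t ht => ?_, ?_⟩, fun h t ht => ?_⟩
    · have := h t (by omega)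
      rwa [dualResidual, if_pos (by omega), sub_eq_iff_eq_add] at this
    · simpa [dualResidual] using h k (by omega)
    · rcases Nat.lt_succ_iff_lt_or_eq.1 ht with hlt | rfl
      · rw [dualResidual, if_pos hlt, sub_eq_iff_eq_add]
        exact h.1 t (by omega)
      · simpa [dualResidual] using h.2
  simp only [Nat.add_sub_cancel]
  constructor
  · intro h
    obtain ⟨q, hq, hc, hB⟩ := exists_nonpos_certificate_of_forall_le (V := ℕ → Fin n → ℝ)
      ((Finset.range (k + 1)).sigma fun t => (Finset.univ : Finset (Fin (m t))))
      (fun p => LinearMap.proj p.2 ∘ₗ ((G p.1).mulVecLin ∘ₗ LinearMap.proj p.1 -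
        (Δ p.1).mulVecLin ∘ₗ LinearMap.proj (p.1 - 1)))
      (fun p => g p.1 p.2)
      (∑ t ∈ Finset.range (k + 1), dotProductBilin ℝ ℝ (x t) ∘ₗ LinearMap.proj t) B
      (by
        obtain ⟨d, hd⟩ := exists_polyAdmissible hΔ0 hne
        refine ⟨d, fun p hp => ?_⟩
        have := hd p.1 (by simpa using hp) p.2
        simpa [le_sub_iff_add_le] using this)
      (by
        intro d hd
        have := h d fun t ht i => by
          simpa [le_sub_iff_add_le] using hd ⟨t, i⟩ (by simpa using ht)
        simpa [dotProduct_comm] using this)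
    set q' : (t : ℕ) → Fin (m t) → ℝ := fun t i => q ⟨t, i⟩ with hq'
    have key : ∀ d : ℕ → Fin n → ℝ, ∑ t ∈ Finset.range (k + 1), d t ⬝ᵥ x t =
        ∑ t ∈ Finset.range (k + 1), d t ⬝ᵥ dualResidual k G Δ q' t := by
      intro d
      rw [← sum_dotProduct_mulVec_sub k G Δ hΔ0]
      have := hc d
      rw [Finset.sum_sigma] at this
      simpa [dotProduct_comm (x _), dotProduct, mul_comm (x _ _)] using this
    have hx : ∀ t < k + 1, dualResidual k G Δ q' t = x t := by
      intro t ht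
      refine dotProduct_eq _ _ fun v => ?_
      have hsingle : ∀ y : ℕ → Fin n → ℝ, ∑ s ∈ Finset.range (k + 1),
          (Pi.single t v : ℕ → Fin n → ℝ) s ⬝ᵥ y s = v ⬝ᵥ y t := fun y => by
        rw [Finset.sum_eq_single_of_mem t (Finset.mem_range.2 ht), Pi.single_eq_same]
        intro s _ hs
        rw [Pi.single_eq_of_ne hs, zero_dotProduct]
      have := key (Pi.single t v)
      rw [hsingle, hsingle] at this
      rw [dotProduct_comm, ← this, dotProduct_comm]
    refine ⟨q', fun t ht i => hq ⟨t, i⟩ (by simpa using ht), ((hres q').1 hx).1,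
      ((hres q').1 hx).2, ?_⟩
    rw [Finset.sum_sigma] at hB
    exact hB
  · rintro ⟨q, hq, h1, h2, hB⟩ d hd
    have hx := (hres q).2 ⟨h1, h2⟩
    calc ∑ t ∈ Finset.range (k + 1), d t ⬝ᵥ x t
        = ∑ t ∈ Finset.range (k + 1), d t ⬝ᵥ dualResidual k G Δ q t :=
          Finset.sum_congr rfl fun t ht => by rw [hx t (Finset.mem_range.1 ht)]
      _ = ∑ t ∈ Finset.range (k + 1), q t ⬝ᵥ (G t *ᵥ d t - Δ t *ᵥ d (t - 1)) :=
          (sum_dotProduct_mulVec_sub k G Δ hΔ0 q d).symm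
      _ ≤ ∑ t ∈ Finset.range (k + 1), g t ⬝ᵥ q t := by
          refine Finset.sum_le_sum fun t ht => ?_
          rw [dotProduct_comm (g t)]
          refine Finset.sum_le_sum fun i _ => ?_
          refine mul_le_mul_of_nonpos_left ?_ (hq t (Finset.mem_range.1 ht) i)
          exact le_sub_iff_add_le.2 (hd t (Finset.mem_range.1 ht) i)
      _ ≤ B := hB
end

section
/- (Two-stage supremum interchange, the inductive step of Proposition 1.) Let Ξ₁ and Ξ₂ be Borel subsets of ℝᵐ, let Ũ₁ be a set of Borel probability measures on ℝᵐ concentrated on Ξ₁, for each d₁ ∈ Ξ₁ let Ũ₂(d₁) be a nonempty set of Borel probability measures on ℝᵐ concentrated on Ξ₂, and let f : ℝᵐ × ℝᵐ → ℝ be bounded and measurable. Define G(d₁) = sup_{Q ∈ Ũ₂(d₁)} ∫ f(d₁, d₂) dQ(d₂). Assume (i) G is measurable on Ξ₁, and (ii) for every ε > 0 there exists a Markov kernel κ_ε from ℝᵐ to ℝᵐ such that for every d₁ ∈ Ξ₁, κ_ε(d₁) ∈ Ũ₂(d₁) and ∫ f(d₁, d₂) dκ_ε(d₁)(d₂) ≥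 G(d₁) − ε. Then sup over all pairs (P₁, κ), where P₁ ∈ Ũ₁ and κ is a Markov kernel with κ(d₁) ∈ Ũ₂(d₁) for P₁-almost every d₁, of ∫∫ f(d₁, d₂) dκ(d₁)(d₂) dP₁(d₁), equals sup_{P₁ ∈ Ũ₁} ∫ G(d₁) dP₁(d₁). -/
open MeasureTheory ProbabilityTheory

/-- A function bounded by `C` has expectation bounded by `C` under a probability measure. -/
theorem abs_integral_le_of_ae_bound {α : Type*} [MeasurableSpace α] (μ : Measure α)
    [IsProbabilityMeasure μ] {g : α → ℝ} {C : ℝ} (hg : ∀ᵐ x ∂μ, |g x| ≤ C) :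
    |∫ x, g x ∂μ| ≤ C := by
  simpa using norm_integral_le_of_norm_le_const (μ := μ) (f := g) (C := C) hg

/-- A bounded function which is measurable on a measurable set of full measure is integrable. -/
theorem integrable_of_measurable_domRestrict_of_bound {α : Type*} [MeasurableSpace α]
    (μ : Measure α) [IsFiniteMeasure μ] {s : Set α} (hs : MeasurableSet s) (hμ : μ sᶜ = 0)
    {g : α → ℝ} (hg : Measurable (s.domRestrict g)) {C : ℝ} (hC : ∀ x ∈ s, |g x| ≤ C) :
    Integrable g μ := by
  have hae : ∀ᵐ x ∂μ, x ∈ s := mem_ae_iff.2 hμ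
  have hm : AEMeasurable g μ := by
    rw [← Measure.restrict_eq_self_of_ae_mem hae]
    exact aemeasurable_restrict_of_measurable_subtype hs hg
  exact .of_bound hm.aestronglyMeasurable C (hae.mono hC)

/-- Two-stage supremum interchange (inductive step of Proposition 1).  Let `Ũ₁` be a
set of Borel probability measures concentrated on `Ξ₁`, and for each `d₁ ∈ Ξ₁` let
`Ũ₂(d₁)` be a nonempty set of Borel probability measures concentrated on `Ξ₂`.  Let
`f` be bounded and measurable and `G(d₁) = sup_{Q ∈ Ũ₂(d₁)} ∫ f(d₁, ·) dQ`.  If `G`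
is measurable on `Ξ₁` and for every `ε > 0` there is a Markov kernel selecting
`ε`-optimal members of `Ũ₂(d₁)` for every `d₁ ∈ Ξ₁`, then the supremum over pairs
`(P₁, κ)` of first-stage marginal `P₁ ∈ Ũ₁` and Markov kernel `κ` with
`κ(d₁) ∈ Ũ₂(d₁)` `P₁`-a.e. of the iterated integral `∫∫ f dκ(d₁) dP₁` equals
`sup_{P₁ ∈ Ũ₁} ∫ G dP₁`. -/
theorem two_stage_sup_interchange
    (m : ℕ) (Ξ₁ Ξ₂ : Set (Fin m → ℝ))
    (hΞ₁ : MeasurableSet Ξ₁) (hΞ₂ : MeasurableSet Ξ₂)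
    (U1 : Set (Measure (Fin m → ℝ)))
    (hU1 : ∀ P ∈ U1, IsProbabilityMeasure P ∧ P Ξ₁ᶜ = 0)
    (U2 : (Fin m → ℝ) → Set (Measure (Fin m → ℝ)))
    (hU2ne : ∀ d₁ ∈ Ξ₁, (U2 d₁).Nonempty)
    (hU2 : ∀ d₁ ∈ Ξ₁, ∀ Q ∈ U2 d₁, IsProbabilityMeasure Q ∧ Q Ξ₂ᶜ = 0)
    (f : (Fin m → ℝ) × (Fin m → ℝ) → ℝ) (hfm : Measurable f)
    (Cf : ℝ) (hfb : ∀ p, |f p| ≤ Cf)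
    (G : (Fin m → ℝ) → ℝ)
    (hG : ∀ d₁ ∈ Ξ₁, IsLUB {z : ℝ | ∃ Q ∈ U2 d₁, z = ∫ d₂, f (d₁, d₂) ∂Q} (G d₁))
    (hGm : Measurable (Ξ₁.restrict G))
    (hsel : ∀ ε > (0 : ℝ), ∃ κ : Kernel (Fin m → ℝ) (Fin m → ℝ),
      IsMarkovKernel κ ∧
      ∀ d₁ ∈ Ξ₁, κ d₁ ∈ U2 d₁ ∧ G d₁ - ε ≤ ∫ d₂, f (d₁, d₂) ∂(κ d₁)) :
    sSup {z : ℝ | ∃ P₁ ∈ U1, ∃ κ : Kernel (Fin m → ℝ) (Fin m → ℝ),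
        IsMarkovKernel κ ∧ (∀ᵐ d₁ ∂P₁, κ d₁ ∈ U2 d₁) ∧
        z = ∫ d₁, (∫ d₂, f (d₁, d₂) ∂(κ d₁)) ∂P₁} =
      sSup {z : ℝ | ∃ P₁ ∈ U1, z = ∫ d₁, G d₁ ∂P₁} := by
  have hmem : ∀ P ∈ U1, ∀ᵐ d ∂P, d ∈ Ξ₁ := fun P hP => mem_ae_iff.2 (hU1 P hP).2
  have hGb : ∀ d ∈ Ξ₁, |G d| ≤ Cf := by
    intro d hd
    have hb : ∀ Q ∈ U2 d, |∫ y, f (d, y) ∂Q| ≤ Cf := fun Q hQ =>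
      have := (hU2 d hd Q hQ).1
      abs_integral_le_of_ae_bound Q (.of_forall fun y => hfb (d, y))
    obtain ⟨Q, hQ⟩ := hU2ne d hd
    refine abs_le.2 ⟨(abs_le.1 (hb Q hQ)).1.trans ((hG d hd).1 ⟨Q, hQ, rfl⟩), (hG d hd).2 ?_⟩
    rintro z ⟨Q', hQ', rfl⟩
    exact (abs_le.1 (hb Q' hQ')).2
  have hGi : ∀ P ∈ U1, Integrable G P := fun P hP =>
    have := (hU1 P hP).1
    integrable_of_measurable_domRestrict_of_bound P hΞ₁ (hU1 P hP).2 hGm hGb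
  have hfib : ∀ κ : Kernel (Fin m → ℝ) (Fin m → ℝ), IsMarkovKernel κ →
      ∀ d, |∫ y, f (d, y) ∂(κ d)| ≤ Cf := fun κ _ d =>
    abs_integral_le_of_ae_bound (κ d) (.of_forall fun y => hfb (d, y))
  have hfi : ∀ P ∈ U1, ∀ κ : Kernel (Fin m → ℝ) (Fin m → ℝ), IsMarkovKernel κ →
      Integrable (fun d => ∫ y, f (d, y) ∂(κ d)) P := fun P hP κ hκ =>
    have := (hU1 P hP).1
    .of_bound hfm.stronglyMeasurable.integral_kernel_prod_right'.aestronglyMeasurable Cf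
      (.of_forall (hfib κ hκ))
  rcases U1.eq_empty_or_nonempty with rfl | ⟨P₀, hP₀⟩
  · simp
  apply le_antisymm
  · obtain ⟨κ, hκ, hκs⟩ := hsel 1 one_pos
    refine csSup_le ⟨_, P₀, hP₀, κ, hκ, (hmem P₀ hP₀).mono fun d hd => (hκs d hd).1, rfl⟩ ?_
    rintro z ⟨P, hP, κ', hκ', hmem', rfl⟩
    have hle : ∫ d, (∫ y, f (d, y) ∂(κ' d)) ∂P ≤ ∫ d, G d ∂P := by
      refine integral_mono_ae (hfi P hP κ' hκ') (hGi P hP) ?_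
      filter_upwards [hmem P hP, hmem'] with d hd hd'
      exact (hG d hd).1 ⟨κ' d, hd', rfl⟩
    refine hle.trans (le_csSup ⟨Cf, ?_⟩ ⟨P, hP, rfl⟩)
    rintro z ⟨P', hP', rfl⟩
    have := (hU1 P' hP').1
    exact (abs_le.1 (abs_integral_le_of_ae_bound P' ((hmem P' hP').mono hGb))).2
  · refine csSup_le ⟨_, P₀, hP₀, rfl⟩ ?_
    rintro z ⟨P, hP, rfl⟩
    have := (hU1 P hP).1
    refine le_of_forall_pos_le_add fun ε hε => ?_
    obtain ⟨κ, hκ, hκs⟩ := hsel ε hε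
    have hle : ∫ d, G d ∂P - ε ≤ ∫ d, (∫ y, f (d, y) ∂(κ d)) ∂P := by
      calc ∫ d, G d ∂P - ε = ∫ d, (G d - ε) ∂P := by
            rw [integral_sub (hGi P hP) (integrable_const ε)]; simp
        _ ≤ _ := integral_mono_ae ((hGi P hP).sub (integrable_const ε)) (hfi P hP κ hκ)
            ((hmem P hP).mono fun d hd => (hκs d hd).2)
    refine sub_le_iff_le_add.1 (hle.trans (le_csSup ⟨Cf, ?_⟩
      ⟨P, hP, κ, hκ, (hmem P hP).mono fun d hd => (hκs d hd).1, rfl⟩))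
    rintro z ⟨P', hP', κ', hκ', -, rfl⟩
    have := (hU1 P' hP').1
    exact (abs_le.1 (abs_integral_le_of_ae_bound P' (.of_forall (hfib κ' hκ')))).2
end

section
/- (Conservativeness of the static DRO reformulation, Theorem on conservative reformulation.) In the connected moment-ambiguity setting, suppose there exist, for each t = 1,…,T, a scalar p_t ∈ ℝ, vectors q_t^u ≥ 0 and q_t^l ≥ 0 in ℝᵐ, and a positive semidefinite m×m matrix R_t, satisfying: (1) p₁ + (q₁^u − q₁^l)ᵀ μ₁ + (q₁^u + q₁^l)ᵀ δ₁ + R₁ · M₁ ≤ B; (2) for each t = 1,…,T−1 and every d ∈ Ξ_t, α_t + β_tᵀ d + dᵀ R_t d − h_t(d) ≥ 0, where α_t = p_t − p_{t+1} − (q_{t+1}^u − q_{t+1}^l)ᵀ b_{t+1} − R_{t+1} · M_{t+1} − (q_{t+1}^u + q_{t+1}^l)ᵀ δ_{t+1} and β_t = q_t^u − q_t^l − 2 R_t μ_t⁰ − A_{t+1}ᵀ q_{t+1}^u + A_{t+1}ᵀ q_{t+1}^l; and (3) for every d ∈ Ξ_T, p_T + (q_T^u − q_T^l − 2 R_T μ_T⁰)ᵀ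 d + dᵀ R_T d ≥ h_T(d). Then the nested worst-case expectation constraint holds: sup_{P ∈ Ũ₁} E_P[h₁(d) + g₁(d)] ≤ B. -/
open MeasureTheory Matrix

/-- The moment-based ambiguity set: Borel probability measures concentrated on `Ξ`,
with finite first and second moments, componentwise mean bound `|E_P[d] − ν| ≤ δv`,
and second-moment bound `E_P[(d − μz)(d − μz)ᵀ] ⪯ S`. -/
def AmbSet (m : ℕ) (Ξ : Set (Fin m → ℝ)) (ν δv μz : Fin m → ℝ)
    (S : Matrix (Fin m) (Fin m) ℝ) : Set (Measure (Fin m → ℝ)) :=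
  {P | IsProbabilityMeasure P ∧ P Ξᶜ = 0 ∧
    (∀ i, Integrable (fun d => d i) P) ∧
    (∀ i j, Integrable (fun d => d i * d j) P) ∧
    (∀ i, |(∫ d, d i ∂P) - ν i| ≤ δv i) ∧
    (S - Matrix.of fun i j => ∫ d, (d i - μz i) * (d j - μz j) ∂P).PosSemidef}

/-- The trace inner product of two positive semidefinite matrices is nonnegative. -/
theorem Matrix.PosSemidef.trace_mul_nonneg_of_real {n : Type*} [Fintype n]
    {R D : Matrix n n ℝ} (hR : R.PosSemidef) (hD : D.PosSemidef) : 0 ≤ (R * D).trace := by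
  obtain ⟨k, v, rfl⟩ := Matrix.posSemidef_iff_eq_sum_vecMulVec.mp hR
  rw [Finset.sum_mul, trace_sum]
  refine Finset.sum_nonneg fun i _ ↦ ?_
  rw [vecMulVec_mul, trace_vecMulVec, dotProduct_comm, ← dotProduct_mulVec]
  exact hD.dotProduct_mulVec_nonneg (v i)

/-- Completing the square: a quadratic function of `d` as an affine function plus a combination
of the entries of the second-moment matrix centred at `c`. -/
theorem quadratic_eq_centred {n : Type*} [Fintype n] {R : Matrix n n ℝ} (hR : R.IsSymm)
    (a : ℝ) (q c d : n → ℝ) :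
    a + (q - (2 : ℝ) • (R *ᵥ c)) ⬝ᵥ d + d ⬝ᵥ (R *ᵥ d) =
      a - (R * vecMulVec c c).trace + ∑ i, q i * d i +
        ∑ i, ∑ j, R i j * ((d j - c j) * (d i - c i)) := by
  have hquad : ∑ i, ∑ j, R i j * ((d j - c j) * (d i - c i)) = (d - c) ⬝ᵥ (R *ᵥ (d - c)) := by
    simp only [dotProduct, mulVec, Finset.mul_sum, Pi.sub_apply]
    exact Finset.sum_congr rfl fun i _ ↦ Finset.sum_congr rfl fun j _ ↦ by ring
  have hcross : d ⬝ᵥ (R *ᵥ c) = c ⬝ᵥ (R *ᵥ d) := by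
    rw [dotProduct_mulVec, ← mulVec_transpose, hR.eq, dotProduct_comm]
  have htr : (R * vecMulVec c c).trace = c ⬝ᵥ (R *ᵥ c) := by
    rw [mul_vecMulVec, trace_vecMulVec, dotProduct_comm]
  rw [hquad, htr, mulVec_sub, dotProduct_sub, sub_dotProduct, sub_dotProduct, sub_dotProduct,
    smul_dotProduct, dotProduct_comm (R *ᵥ c) d, ← hcross, smul_eq_mul]
  simp only [dotProduct]
  ring

/-- Weak duality for a moment ambiguity set: a quadratic majorant of `f` on the support bounds
every expectation of `f` by the dual objective. -/
theorem integral_le_of_mem_AmbSet {m : ℕ} {Ξ : Set (Fin m → ℝ)} {ν δ c : Fin m → ℝ}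
    {S : Matrix (Fin m) (Fin m) ℝ} {P : Measure (Fin m → ℝ)} (hP : P ∈ AmbSet m Ξ ν δ c S)
    {f : (Fin m → ℝ) → ℝ} (hf : Integrable f P) (a : ℝ) {u l : Fin m → ℝ}
    (hu : ∀ i, 0 ≤ u i) (hl : ∀ i, 0 ≤ l i) {R : Matrix (Fin m) (Fin m) ℝ} (hR : R.PosSemidef)
    (hmaj : ∀ d ∈ Ξ, f d ≤ a + (u - l - (2 : ℝ) • (R *ᵥ c)) ⬝ᵥ d + d ⬝ᵥ (R *ᵥ d)) :
    ∫ d, f d ∂P ≤ a + (u - l) ⬝ᵥ ν + (u + l) ⬝ᵥ δ + (R * (S - vecMulVec c c)).trace := by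
  obtain ⟨hprob, hsupp, hfst, hsnd, hmean, hcov⟩ := hP
  have hcen (i j) : Integrable (fun d : Fin m → ℝ ↦ (d i - c i) * (d j - c j)) P := by
    have := (((hsnd i j).sub ((hfst i).mul_const (c j))).sub ((hfst j).const_mul (c i))).add
      (integrable_const (c i * c j))
    refine this.congr (.of_forall fun d ↦ ?_)
    simp only [Pi.add_apply, Pi.sub_apply]
    ring
  have hlin : Integrable (fun d : Fin m → ℝ ↦ ∑ i, (u - l) i * d i) P :=
    integrable_finsetSum _ fun i _ ↦ (hfst i).const_mul _
  have hrow (i) : Integrable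
      (fun d : Fin m → ℝ ↦ ∑ j, R i j * ((d j - c j) * (d i - c i))) P :=
    integrable_finsetSum _ fun j _ ↦ (hcen j i).const_mul _
  have hquad : Integrable
      (fun d : Fin m → ℝ ↦ ∑ i, ∑ j, R i j * ((d j - c j) * (d i - c i))) P :=
    integrable_finsetSum _ fun i _ ↦ hrow i
  have haff : Integrable (fun d : Fin m → ℝ ↦
      a - (R * vecMulVec c c).trace + ∑ i, (u - l) i * d i) P :=
    (integrable_const _).add hlin
  set C : Matrix (Fin m) (Fin m) ℝ :=
    Matrix.of fun i j ↦ ∫ d, (d i - c i) * (d j - c j) ∂P with hC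
  have hle : ∫ d, f d ∂P ≤ a - (R * vecMulVec c c).trace +
      ∑ i, (u - l) i * ∫ d, d i ∂P + (R * C).trace := by
    calc
      ∫ d, f d ∂P ≤ ∫ d, (a - (R * vecMulVec c c).trace + ∑ i, (u - l) i * d i +
          ∑ i, ∑ j, R i j * ((d j - c j) * (d i - c i))) ∂P := by
        refine integral_mono_ae hf (haff.add hquad) ?_
        have hmem : ∀ᵐ d ∂P, d ∈ Ξ := hsupp
        filter_upwards [hmem] with d hd
        rw [← quadratic_eq_centred (isHermitian_iff_isSymm.mp hR.isHermitian)]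
        exact hmaj d hd
      _ = _ := by
        rw [integral_add haff hquad, integral_add (integrable_const _) hlin,
          integral_finsetSum _ fun i _ ↦ (hfst i).const_mul _,
          integral_finsetSum _ fun i _ ↦ hrow i]
        simp only [integral_finsetSum _ fun j _ ↦ (hcen j _).const_mul _, integral_const_mul,
          integral_const, probReal_univ, one_smul, trace, diag, mul_apply, hC, of_apply]
  have hbound : ∑ i, (u - l) i * ∫ d, d i ∂P ≤ (u - l) ⬝ᵥ ν + (u + l) ⬝ᵥ δ := by
    simp only [dotProduct, ← Finset.sum_add_distrib]
    refine Finset.sum_le_sum fun i _ ↦ ?_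
    obtain ⟨hlo, hhi⟩ := abs_le.mp (hmean i)
    simp only [Pi.sub_apply, Pi.add_apply]
    linarith [mul_le_mul_of_nonneg_left hhi (hu i), mul_le_mul_of_nonneg_left hlo (hl i)]
  have htr := hR.trace_mul_nonneg_of_real hcov
  rw [Matrix.mul_sub, trace_sub] at htr ⊢
  linarith

/-- Conservativeness of the static DRO reformulation (Theorem on conservative
reformulation), 0-indexed in `t = 0,…,T−1`.  The value functions `g` satisfy
`g_T = 0` and `g_t(d) = sup_{P ∈ Ũ_{t+1}(d)} E_P[h_{t+1} + g_{t+1}]`, where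
`Ũ_{t+1}(d)` has mean bound centered at `A_{t+1} d + b_{t+1}`.  If constant dual
variables `(p_t, q_tᵘ ≥ 0, q_tˡ ≥ 0, R_t ⪰ 0)` satisfy the budget inequality (1),
the linking constraints (2) for `t = 0,…,T−2`, and the last-period constraint (3),
then `sup_{P ∈ Ũ₁} E_P[h₁ + g₁] ≤ B`, i.e. `E_P[h₀ + g₀] ≤ B` for all `P ∈ Ũ₁`. -/
theorem connected_dro_conservative_reformulation
    (T m : ℕ) (hT : 1 ≤ T) (hm : 1 ≤ m)
    (Ξ : ℕ → Set (Fin m → ℝ)) (hΞ : ∀ t, MeasurableSet (Ξ t))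
    (δ : ℕ → Fin m → ℝ) (hδ : ∀ t i, 0 ≤ δ t i)
    (μz : ℕ → Fin m → ℝ)
    (Sig : ℕ → Matrix (Fin m) (Fin m) ℝ) (hSig : ∀ t, (Sig t).IsSymm)
    (h : ℕ → (Fin m → ℝ) → ℝ) (hhm : ∀ t, Measurable (h t))
    (μ1 : Fin m → ℝ) (A : ℕ → Matrix (Fin m) (Fin m) ℝ) (b : ℕ → Fin m → ℝ)
    (g : ℕ → (Fin m → ℝ) → ℝ)
    (hgT : ∀ d, g (T - 1) d = 0)
    (hgrec : ∀ t, t + 1 < T → ∀ d ∈ Ξ t,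
      g t d = sSup {z : ℝ | ∃ P ∈ AmbSet m (Ξ (t + 1)) (A (t + 1) *ᵥ d + b (t + 1))
          (δ (t + 1)) (μz (t + 1)) (Sig (t + 1)),
        z = ∫ e, (h (t + 1) e + g (t + 1) e) ∂P})
    (hne : ∀ t, t + 1 < T → ∀ d ∈ Ξ t,
      (AmbSet m (Ξ (t + 1)) (A (t + 1) *ᵥ d + b (t + 1))
        (δ (t + 1)) (μz (t + 1)) (Sig (t + 1))).Nonempty)
    (hint : ∀ t, t + 1 < T → ∀ d ∈ Ξ t,
      ∀ P ∈ AmbSet m (Ξ (t + 1)) (A (t + 1) *ᵥ d + b (t + 1))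
          (δ (t + 1)) (μz (t + 1)) (Sig (t + 1)),
        Integrable (fun e => h (t + 1) e + g (t + 1) e) P)
    (hint0 : ∀ P ∈ AmbSet m (Ξ 0) μ1 (δ 0) (μz 0) (Sig 0),
      Integrable (fun e => h 0 e + g 0 e) P)
    (B : ℝ)
    (p : ℕ → ℝ) (qu ql : ℕ → Fin m → ℝ)
    (hqu : ∀ t i, 0 ≤ qu t i) (hql : ∀ t i, 0 ≤ ql t i)
    (R : ℕ → Matrix (Fin m) (Fin m) ℝ) (hR : ∀ t, (R t).PosSemidef)
    (h1 : p 0 + (qu 0 - ql 0) ⬝ᵥ μ1 + (qu 0 + ql 0) ⬝ᵥ δ 0 +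
      (R 0 * (Sig 0 - vecMulVec (μz 0) (μz 0))).trace ≤ B)
    (h2 : ∀ t, t + 1 < T → ∀ d ∈ Ξ t,
      0 ≤ (p t - p (t + 1) - (qu (t + 1) - ql (t + 1)) ⬝ᵥ b (t + 1) -
            (R (t + 1) * (Sig (t + 1) - vecMulVec (μz (t + 1)) (μz (t + 1)))).trace -
            (qu (t + 1) + ql (t + 1)) ⬝ᵥ δ (t + 1)) +
          (qu t - ql t - (2 : ℝ) • (R t *ᵥ μz t) -
            (A (t + 1))ᵀ *ᵥ qu (t + 1) + (A (t + 1))ᵀ *ᵥ ql (t + 1)) ⬝ᵥ d +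
          d ⬝ᵥ (R t *ᵥ d) - h t d)
    (h3 : ∀ d ∈ Ξ (T - 1),
      h (T - 1) d ≤ p (T - 1) +
        (qu (T - 1) - ql (T - 1) - (2 : ℝ) • (R (T - 1) *ᵥ μz (T - 1))) ⬝ᵥ d +
        d ⬝ᵥ (R (T - 1) *ᵥ d)) :
    ∀ P ∈ AmbSet m (Ξ 0) μ1 (δ 0) (μz 0) (Sig 0),
      ∫ d, (h 0 d + g 0 d) ∂P ≤ B := by
  have key : ∀ k t, t + k + 1 = T → ∀ d ∈ Ξ t, h t d + g t d ≤
      p t + (qu t - ql t - (2 : ℝ) • (R t *ᵥ μz t)) ⬝ᵥ d + d ⬝ᵥ (R t *ᵥ d) := by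
    intro k
    induction k with
    | zero =>
      intro t ht d hd
      obtain rfl : t = T - 1 := by omega
      simpa only [hgT, add_zero] using h3 d hd
    | succ k ih =>
      intro t ht d hd
      have htT : t + 1 < T := by omega
      have hg : g t d ≤ p (t + 1) + (qu (t + 1) - ql (t + 1)) ⬝ᵥ (A (t + 1) *ᵥ d + b (t + 1)) +
          (qu (t + 1) + ql (t + 1)) ⬝ᵥ δ (t + 1) +
          (R (t + 1) * (Sig (t + 1) - vecMulVec (μz (t + 1)) (μz (t + 1)))).trace := by
        rw [hgrec t htT d hd]
        obtain ⟨Q, hQ⟩ := hne t htT d hd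
        refine csSup_le ⟨_, Q, hQ, rfl⟩ ?_
        rintro _ ⟨P, hP, rfl⟩
        exact integral_le_of_mem_AmbSet hP (hint t htT d hd P hP) (p (t + 1)) (hqu _) (hql _)
          (hR _) (ih (t + 1) (by omega))
      have hlink := h2 t htT d hd
      simp only [dotProduct_add, add_dotProduct, sub_dotProduct, dotProduct_mulVec,
        mulVec_transpose, smul_dotProduct, sub_vecMul] at hg hlink ⊢
      linarith
  intro P hP
  exact (integral_le_of_mem_AmbSet hP (hint0 P hP) (p 0) (hqu 0) (hql 0) (hR 0)
    (key (T - 1) 0 (by omega))).trans h1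
end

section
/- (Sufficiency direction of the exact DRO reformulation, Theorem on exact reformulation.) In the connected moment-ambiguity setting, suppose there exist measurable functions p_t : Ξ_{t−1} → ℝ, q_t^u, q_t^l : Ξ_{t−1} → ℝᵐ with q_t^u(·) ≥ 0 and q_t^l(·) ≥ 0, and R_t : Ξ_{t−1} → (positive semidefinite m×m matrices) for t = 1,…,T (with the t = 1 variables constant), satisfying: (1) p₁ + (q₁^u − q₁^l)ᵀ μ₁ + (q₁^u + q₁^l)ᵀ δ₁ + R₁ · M₁ ≤ B; (2) for each t = 1,…,T−1 and every (d_{t−1}, d_t) ∈ Ξ_{t−1} × Ξ_t, α_t(d_{t−1}, d_t) + β_t(d_{t−1}, d_t)ᵀ d_t + d_tᵀ R_t(d_{t−1}) d_t − h_t(d_t) ≥ 0, where α_t(d_{t−1}, d_t) = p_t(d_{t−1}) − p_{t+1}(d_t) − (q_{t+1}^u(d_t) − q_{t+1}^l(d_t))ᵀ b_{t+1} − R_{t+1}(d_t) · M_{t+1} − (q_{t+1}^u(d_t) + q_{t+1}^l(d_t))ᵀ δ_{t+1} and β_t(d_{t−1}, d_t) = q_t^u(d_{t−1}) − q_t^l(d_{t−1})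 − 2 R_t(d_{t−1}) μ_t⁰ − A_{t+1}ᵀ q_{t+1}^u(d_t) + A_{t+1}ᵀ q_{t+1}^l(d_t); and (3) for every (d_{T−1}, d_T) ∈ Ξ_{T−1} × Ξ_T, p_T(d_{T−1}) + (q_T^u(d_{T−1}) − q_T^l(d_{T−1}) − 2 R_T(d_{T−1}) μ_T⁰)ᵀ d_T + d_Tᵀ R_T(d_{T−1}) d_T ≥ h_T(d_T). Then the nested worst-case expectation constraint holds: sup_{P ∈ Ũ₁} E_P[h₁(d) + g₁(d)] ≤ B. -/
open MeasureTheory Matrix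

/-- The trace of the product of two real positive semidefinite matrices is nonnegative. -/
theorem trace_mul_nonneg_of_posSemidef {m : ℕ} {R M : Matrix (Fin m) (Fin m) ℝ}
    (hR : R.PosSemidef) (hM : M.PosSemidef) : 0 ≤ (R * M).trace := by
  obtain ⟨C, rfl⟩ : ∃ C : Matrix (Fin m) (Fin m) ℝ, R = Cᴴ * C := by
    open scoped MatrixOrder in
    obtain ⟨C, hC⟩ := CStarAlgebra.nonneg_iff_eq_star_mul_self.mp hR.nonneg
    exact ⟨C, hC⟩
  rw [Matrix.mul_assoc, Matrix.trace_mul_comm]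
  exact (hM.mul_mul_conjTranspose_same C).trace_nonneg

/-- Completing the square: a quadratic with linear part shifted by `-2 R z` is a quadratic
in the centred variable `d - z`. -/
theorem quadratic_eq_centered {m : ℕ} {R : Matrix (Fin m) (Fin m) ℝ} (hR : R.IsSymm)
    (c z d : Fin m → ℝ) :
    (c - (2 : ℝ) • (R *ᵥ z)) ⬝ᵥ d + d ⬝ᵥ (R *ᵥ d) =
      c ⬝ᵥ d + (d - z) ⬝ᵥ (R *ᵥ (d - z)) - z ⬝ᵥ (R *ᵥ z) := by
  have hsymm : z ⬝ᵥ (R *ᵥ d) = d ⬝ᵥ (R *ᵥ z) := by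
    rw [dotProduct_mulVec, ← mulVec_transpose, hR.eq, dotProduct_comm]
  simp only [sub_dotProduct, dotProduct_sub, mulVec_sub, smul_dotProduct, smul_eq_mul]
  rw [hsymm, dotProduct_comm (R *ᵥ z) d]
  ring

/-- Weak duality for the moment problem over `AmbSet`: an integrable function dominated on the
support by a quadratic with multipliers `p`, `qu`, `ql`, `R` has expectation at most the dual
objective value. -/
theorem AmbSet.integral_le_dual {m : ℕ} {Ξ : Set (Fin m → ℝ)} {ν δv z : Fin m → ℝ}
    {S : Matrix (Fin m) (Fin m) ℝ} {P : Measure (Fin m → ℝ)} (hP : P ∈ AmbSet m Ξ ν δv z S)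
    {F : (Fin m → ℝ) → ℝ} (hF : Integrable F P) {p : ℝ} {qu ql : Fin m → ℝ}
    {R : Matrix (Fin m) (Fin m) ℝ} (hqu : ∀ i, 0 ≤ qu i) (hql : ∀ i, 0 ≤ ql i)
    (hR : R.PosSemidef)
    (hle : ∀ d ∈ Ξ, F d ≤ p + (qu - ql - (2 : ℝ) • (R *ᵥ z)) ⬝ᵥ d + d ⬝ᵥ (R *ᵥ d)) :
    ∫ d, F d ∂P ≤ p + (qu - ql) ⬝ᵥ ν + (qu + ql) ⬝ᵥ δv +
      (R * (S - vecMulVec z z)).trace := by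
  obtain ⟨hprob, hsupp, hint1, hint2, hmean, hcov⟩ := hP
  have hRsymm : R.IsSymm := by
    have := hR.isHermitian
    rwa [Matrix.IsHermitian, conjTranspose_eq_transpose_of_trivial] at this
  have hcint (i j : Fin m) : Integrable (fun d : Fin m → ℝ => (d i - z i) * (d j - z j)) P := by
    have : (fun d : Fin m → ℝ => (d i - z i) * (d j - z j)) =
        fun d => d i * d j - z j * d i - z i * d j + z i * z j := by
      ext d; ring
    rw [this]
    exact (((hint2 i j).sub ((hint1 i).const_mul _)).sub ((hint1 j).const_mul _)).add
      (integrable_const _)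
  set k : ℝ := p - z ⬝ᵥ (R *ᵥ z) with hk
  have hlin : Integrable (fun d : Fin m → ℝ => ∑ i, (qu - ql) i * d i) P :=
    integrable_finsetSum _ fun i _ => (hint1 i).const_mul _
  have haff : Integrable (fun d : Fin m → ℝ => k + ∑ i, (qu - ql) i * d i) P :=
    (integrable_const k).add hlin
  have hrow (i : Fin m) :
      Integrable (fun d : Fin m → ℝ => ∑ j, R i j * ((d i - z i) * (d j - z j))) P :=
    integrable_finsetSum _ fun j _ => (hcint i j).const_mul _
  have hquad : Integrable
      (fun d : Fin m → ℝ => ∑ i, ∑ j, R i j * ((d i - z i) * (d j - z j))) P :=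
    integrable_finsetSum _ fun i _ => hrow i
  have hae : F ≤ᵐ[P] fun d => k + ∑ i, (qu - ql) i * d i +
      ∑ i, ∑ j, R i j * ((d i - z i) * (d j - z j)) := by
    have hmem : ∀ᵐ d ∂P, d ∈ Ξ := mem_ae_iff.mpr hsupp
    filter_upwards [hmem] with d hd
    refine (hle d hd).trans_eq ?_
    have hexp : (d - z) ⬝ᵥ (R *ᵥ (d - z)) =
        ∑ i, ∑ j, R i j * ((d i - z i) * (d j - z j)) := by
      simp only [dotProduct, mulVec, Finset.mul_sum, Pi.sub_apply]
      exact Finset.sum_congr rfl fun i _ => Finset.sum_congr rfl fun j _ => by ring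
    rw [add_assoc, quadratic_eq_centered hRsymm, hexp, hk, dotProduct]
    ring
  have hI := integral_mono_ae hF (haff.add hquad) hae
  have hval : ∫ d, (k + ∑ i, (qu - ql) i * d i +
      ∑ i, ∑ j, R i j * ((d i - z i) * (d j - z j))) ∂P =
      k + ∑ i, (qu - ql) i * ∫ d, d i ∂P +
        ∑ i, ∑ j, R i j * ∫ d, (d i - z i) * (d j - z j) ∂P := by
    rw [integral_add haff hquad,
      integral_add (integrable_const k) hlin, integral_const,
      integral_finsetSum _ fun i _ => (hint1 i).const_mul _,
      integral_finsetSum _ fun i _ => hrow i]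
    simp only [probReal_univ, one_smul, integral_const_mul]
    congr 1
    refine Finset.sum_congr rfl fun i _ => ?_
    rw [integral_finsetSum _ fun j _ => (hcint i j).const_mul _]
    simp only [integral_const_mul]
  have hmean' : ∑ i, (qu - ql) i * ∫ d, d i ∂P ≤ (qu - ql) ⬝ᵥ ν + (qu + ql) ⬝ᵥ δv := by
    simp only [dotProduct, ← Finset.sum_add_distrib]
    refine Finset.sum_le_sum fun i _ => ?_
    obtain ⟨hl, hu⟩ := abs_le.mp (hmean i)
    simp only [Pi.sub_apply, Pi.add_apply]
    nlinarith [mul_le_mul_of_nonneg_left hu (hqu i), mul_le_mul_of_nonneg_left hl (hql i)]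
  have htr := trace_mul_nonneg_of_posSemidef hR hcov
  have htrC : (R * Matrix.of fun i j => ∫ d, (d i - z i) * (d j - z j) ∂P).trace =
      ∑ i, ∑ j, R i j * ∫ d, (d i - z i) * (d j - z j) ∂P := by
    simp only [trace, diag_apply, mul_apply, of_apply]
    exact Finset.sum_congr rfl fun i _ => Finset.sum_congr rfl fun j _ => by
      simp only [mul_comm (_ - z j)]
  have htrz : (R * vecMulVec z z).trace = z ⬝ᵥ (R *ᵥ z) := by
    rw [mul_vecMulVec, trace_vecMulVec, dotProduct_comm]
  rw [Matrix.mul_sub, trace_sub] at htr ⊢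
  rw [htrC] at htr
  rw [htrz]
  have hI' := hI.trans_eq hval
  linarith

/-- Sufficiency direction of the exact DRO reformulation, 0-indexed in
`t = 0,…,T−1`.  The value functions `g` satisfy `g_T = 0` and
`g_t(d) = sup_{P ∈ Ũ_{t+1}(d)} E_P[h_{t+1} + g_{t+1}]`.  Here the dual variables of
period `t` are measurable functions of the previous realization, defined on
`Ξp t`, where `Ξp 0 = {d0}` is a one-point set (so the first-period duals are
constants) and `Ξp (t+1) = Ξ t`.  If they satisfy the budget inequality (1), the
linking constraints (2) for `t = 0,…,T−2`, and the last-period constraint (3), then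
`sup_{P ∈ Ũ₁} E_P[h₁ + g₁] ≤ B`, i.e. `E_P[h₀ + g₀] ≤ B` for all `P ∈ Ũ₁`. -/
theorem connected_dro_exact_reformulation_sufficiency
    (T m : ℕ) (hT : 1 ≤ T) (hm : 1 ≤ m)
    (Ξ : ℕ → Set (Fin m → ℝ)) (hΞ : ∀ t, MeasurableSet (Ξ t))
    (δ : ℕ → Fin m → ℝ) (hδ : ∀ t i, 0 ≤ δ t i)
    (μz : ℕ → Fin m → ℝ)
    (Sig : ℕ → Matrix (Fin m) (Fin m) ℝ) (hSig : ∀ t, (Sig t).IsSymm)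
    (h : ℕ → (Fin m → ℝ) → ℝ) (hhm : ∀ t, Measurable (h t))
    (μ1 : Fin m → ℝ) (A : ℕ → Matrix (Fin m) (Fin m) ℝ) (b : ℕ → Fin m → ℝ)
    (g : ℕ → (Fin m → ℝ) → ℝ)
    (hgT : ∀ d, g (T - 1) d = 0)
    (hgrec : ∀ t, t + 1 < T → ∀ d ∈ Ξ t,
      g t d = sSup {z : ℝ | ∃ P ∈ AmbSet m (Ξ (t + 1)) (A (t + 1) *ᵥ d + b (t + 1))
          (δ (t + 1)) (μz (t + 1)) (Sig (t + 1)),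
        z = ∫ e, (h (t + 1) e + g (t + 1) e) ∂P})
    (hne : ∀ t, t + 1 < T → ∀ d ∈ Ξ t,
      (AmbSet m (Ξ (t + 1)) (A (t + 1) *ᵥ d + b (t + 1))
        (δ (t + 1)) (μz (t + 1)) (Sig (t + 1))).Nonempty)
    (hint : ∀ t, t + 1 < T → ∀ d ∈ Ξ t,
      ∀ P ∈ AmbSet m (Ξ (t + 1)) (A (t + 1) *ᵥ d + b (t + 1))
          (δ (t + 1)) (μz (t + 1)) (Sig (t + 1)),
        Integrable (fun e => h (t + 1) e + g (t + 1) e) P)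
    (hint0 : ∀ P ∈ AmbSet m (Ξ 0) μ1 (δ 0) (μz 0) (Sig 0),
      Integrable (fun e => h 0 e + g 0 e) P)
    (B : ℝ)
    -- shifted supports for the dual variables: `Ξp 0` is a one-point set and
    -- `Ξp (t+1) = Ξ t`
    (d0 : Fin m → ℝ) (Ξp : ℕ → Set (Fin m → ℝ))
    (hΞp0 : Ξp 0 = {d0}) (hΞpS : ∀ t, Ξp (t + 1) = Ξ t)
    -- measurable dual-variable functions of the previous realization
    (p : ℕ → (Fin m → ℝ) → ℝ)
    (qu ql : ℕ → (Fin m → ℝ) → Fin m → ℝ)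
    (R : ℕ → (Fin m → ℝ) → Matrix (Fin m) (Fin m) ℝ)
    (hpm : ∀ t, Measurable ((Ξp t).restrict (p t)))
    (hqum : ∀ t, Measurable ((Ξp t).restrict (qu t)))
    (hqlm : ∀ t, Measurable ((Ξp t).restrict (ql t)))
    (hRm : ∀ t i j, Measurable ((Ξp t).restrict fun dp => R t dp i j))
    (hqu0 : ∀ t, ∀ dp ∈ Ξp t, ∀ i, 0 ≤ qu t dp i)
    (hql0 : ∀ t, ∀ dp ∈ Ξp t, ∀ i, 0 ≤ ql t dp i)
    (hRpsd : ∀ t, ∀ dp ∈ Ξp t, (R t dp).PosSemidef)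
    (h1 : p 0 d0 + (qu 0 d0 - ql 0 d0) ⬝ᵥ μ1 + (qu 0 d0 + ql 0 d0) ⬝ᵥ δ 0 +
      (R 0 d0 * (Sig 0 - vecMulVec (μz 0) (μz 0))).trace ≤ B)
    (h2 : ∀ t, t + 1 < T → ∀ dp ∈ Ξp t, ∀ d ∈ Ξ t,
      0 ≤ (p t dp - p (t + 1) d - (qu (t + 1) d - ql (t + 1) d) ⬝ᵥ b (t + 1) -
            (R (t + 1) d * (Sig (t + 1) - vecMulVec (μz (t + 1)) (μz (t + 1)))).trace -
            (qu (t + 1) d + ql (t + 1) d) ⬝ᵥ δ (t + 1)) +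
          (qu t dp - ql t dp - (2 : ℝ) • (R t dp *ᵥ μz t) -
            (A (t + 1))ᵀ *ᵥ qu (t + 1) d + (A (t + 1))ᵀ *ᵥ ql (t + 1) d) ⬝ᵥ d +
          d ⬝ᵥ (R t dp *ᵥ d) - h t d)
    (h3 : ∀ dp ∈ Ξp (T - 1), ∀ d ∈ Ξ (T - 1),
      h (T - 1) d ≤ p (T - 1) dp +
        (qu (T - 1) dp - ql (T - 1) dp - (2 : ℝ) • (R (T - 1) dp *ᵥ μz (T - 1))) ⬝ᵥ d +
        d ⬝ᵥ (R (T - 1) dp *ᵥ d)) :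
    ∀ P ∈ AmbSet m (Ξ 0) μ1 (δ 0) (μz 0) (Sig 0),
      ∫ d, (h 0 d + g 0 d) ∂P ≤ B := by
  have hdom : ∀ n t, t + n + 1 = T → ∀ dp ∈ Ξp t, ∀ d ∈ Ξ t,
      h t d + g t d ≤ p t dp +
        (qu t dp - ql t dp - (2 : ℝ) • (R t dp *ᵥ μz t)) ⬝ᵥ d + d ⬝ᵥ (R t dp *ᵥ d) := by
    intro n
    induction n with
    | zero =>
      intro t ht dp hdp d hd
      obtain rfl : t = T - 1 := by lia
      rw [hgT, add_zero]
      exact h3 dp hdp d hd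
    | succ n ih =>
      intro t ht dp hdp d hd
      have htT : t + 1 < T := by lia
      have hd' : d ∈ Ξp (t + 1) := hΞpS t ▸ hd
      have hg : g t d ≤ p (t + 1) d +
          (qu (t + 1) d - ql (t + 1) d) ⬝ᵥ (A (t + 1) *ᵥ d + b (t + 1)) +
          (qu (t + 1) d + ql (t + 1) d) ⬝ᵥ δ (t + 1) +
          (R (t + 1) d * (Sig (t + 1) - vecMulVec (μz (t + 1)) (μz (t + 1)))).trace := by
        rw [hgrec t htT d hd]
        obtain ⟨P₀, hP₀⟩ := hne t htT d hd
        refine csSup_le ⟨_, P₀, hP₀, rfl⟩ ?_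
        rintro _ ⟨P, hP, rfl⟩
        exact AmbSet.integral_le_dual hP (hint t htT d hd P hP) (hqu0 _ d hd') (hql0 _ d hd')
          (hRpsd _ d hd') (ih (t + 1) (by lia) d hd')
      have hlink := h2 t htT dp hdp d hd
      have htransp (q : Fin m → ℝ) : ((A (t + 1))ᵀ *ᵥ q) ⬝ᵥ d = q ⬝ᵥ (A (t + 1) *ᵥ d) := by
        rw [mulVec_transpose, dotProduct_mulVec]
      simp only [sub_dotProduct, add_dotProduct, dotProduct_add, htransp] at hg hlink ⊢
      linarith
  intro P hP
  have hd0 : d0 ∈ Ξp 0 := by simp [hΞp0]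
  exact (AmbSet.integral_le_dual hP (hint0 P hP) (hqu0 0 d0 hd0) (hql0 0 d0 hd0)
    (hRpsd 0 d0 hd0) (hdom (T - 1) 0 (by lia) d0 hd0)).trans h1
end
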